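/- For all n ≥ 1, all j ≥ 0 and all k ≥ 2, the following identity of binomial-coefficient sums holds: Σ_{j ≥ i_{k−1} ≥ … ≥ i_1 ≥ 0} Π_{m=0}^{k−1} C(i_{m+2} + i_m, 2·i_{m+1}) = (1/n)·C(n, j+1)·C(n, j) − Q̃_1(n, j, k+2) + 2·Q̃_0(n, j, k+2) − Q̃_{−1}(n, j, k+2), where in the left-hand sum i_0 = 0, i_k = j, i_{k+1} = n, and where for a ∈ {−1, 0, 1}, Q̃_a(n, j, k+2) = Σ_{s≥1} C(n−(k+1)s−1, j−(k+2)s−a) · C(n+(k+1)s−1, j+(k+2)s+a), a finite sum since C(m, r) = 0 for r < 0 or r > m. -/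

import Mathlib

/-- The binomial coefficient $C(m,r)$ for integers, with $C(m,r) = 0$ unless $0 ≤ r ≤ m$. -/
def chooseZ (m r : ℤ) : ℤ :=
  if 0 ≤ r ∧ r ≤ m then (m.toNat.choose r.toNat : ℤ) else 0

/-- $\widetilde{Q}_a(n,j,k+2) = \sum_{s ≥ 1} C(n-(k+1)s-1, j-(k+2)s-a) \cdot
C(n+(k+1)s-1, j+(k+2)s+a)$; the sum is finite since all terms with $s > j+1$ vanish. -/
def Qt (a : ℤ) (n j k : ℕ) : ℚ :=
  ∑ s ∈ Finset.Icc 1 (j + 1),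
    ((chooseZ ((n : ℤ) - ((k : ℤ) + 1) * (s : ℤ) - 1) ((j : ℤ) - ((k : ℤ) + 2) * (s : ℤ) - a) *
        chooseZ ((n : ℤ) + ((k : ℤ) + 1) * (s : ℤ) - 1)
          ((j : ℤ) + ((k : ℤ) + 2) * (s : ℤ) + a) : ℤ) : ℚ)

/-- The extended chain $i_0 = 0, i_1, …, i_{k-1}, i_k = j, i_{k+1} = n$ determined by a
tuple $g = (i_1, …, i_{k-1})$ (indexed by `Fin (k-1)`); `V n j k g m` is $i_m$. -/
def V (n j k : ℕ) (g : Fin (k - 1) → ℕ) (m : ℕ) : ℕ :=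
  if h : 1 ≤ m ∧ m ≤ k - 1 then g ⟨m - 1, by omega⟩
  else if m = k then j
  else if m = k + 1 then n
  else 0

theorem Nat.sum_antidiagonal_choose_mul_choose_mul_choose (M N P p r : ℕ) (h : P + p = M + N) :
    ∑ x ∈ Finset.HasAntidiagonal.antidiagonal p, M.choose x.1 * N.choose x.2 * (r + x.1).choose (M + N) =
      r.choose P * (M + r - P).choose p := by
  have expand : ∀ K ≤ p, (r + K).choose (M + N) =
      ∑ t ∈ Finset.range (p + 1), r.choose (M + N - t) * K.choose t := by
    intro K hK
    rw [Nat.add_choose_eq, Finset.Nat.sum_antidiagonal_eq_sum_range_succ_mk,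
      ← Finset.sum_range_reflect]
    symm
    refine Finset.sum_subset_zero_on_sdiff (by intro x; simp; omega) ?_ ?_
    · intro t ht
      simp only [Finset.mem_sdiff, Finset.mem_range] at ht
      rw [Nat.choose_eq_zero_of_lt (n := K) (by omega), mul_zero]
    · intro t ht
      rw [Finset.mem_range] at ht
      congr 2; omega
  have inner : ∀ t ∈ Finset.range (p + 1),
      ∑ x ∈ Finset.HasAntidiagonal.antidiagonal p, M.choose x.1 * N.choose x.2 * x.1.choose t =
        M.choose t * (M + N - t).choose (p - t) := by
    intro t ht
    rw [Finset.mem_range] at ht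
    by_cases hM : M < t
    · rw [Nat.choose_eq_zero_of_lt hM, zero_mul]
      refine Finset.sum_eq_zero fun x _ => ?_
      rcases lt_or_ge M x.1 with h1 | h1
      · simp [Nat.choose_eq_zero_of_lt h1]
      · simp [Nat.choose_eq_zero_of_lt (show x.1 < t by omega)]
    push Not at hM
    rw [show M + N - t = (M - t) + N by omega, Nat.add_choose_eq, Finset.mul_sum]
    symm
    refine Finset.sum_of_injOn (fun x => (x.1 + t, x.2)) ?_ ?_ ?_ ?_
    · rintro ⟨a, b⟩ _ ⟨c, d⟩ _ h
      simp only [Prod.mk.injEq] at h ⊢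
      omega
    · rintro ⟨a, b⟩ h
      simp only [Finset.mem_coe, Finset.HasAntidiagonal.mem_antidiagonal] at h ⊢
      omega
    · rintro ⟨a, b⟩ h h'
      rw [Finset.HasAntidiagonal.mem_antidiagonal] at h
      have : a < t := by
        by_contra hc
        apply h'
        refine ⟨(a - t, b), ?_, ?_⟩
        · simp only [Finset.mem_coe, Finset.HasAntidiagonal.mem_antidiagonal]; dsimp only at h; omega
        · simp only [Prod.mk.injEq, and_true]; omega
      simp [Nat.choose_eq_zero_of_lt this]
    · rintro ⟨a, b⟩ h
      dsimp only
      have := Nat.choose_mul (n := M) (Nat.le_add_left t a)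
      rw [Nat.add_sub_cancel] at this
      rw [mul_right_comm, this]; ring
  calc _ = ∑ x ∈ Finset.HasAntidiagonal.antidiagonal p, ∑ t ∈ Finset.range (p + 1),
          r.choose (M + N - t) * (M.choose x.1 * N.choose x.2 * x.1.choose t) := by
        refine Finset.sum_congr rfl fun x hx => ?_
        rw [expand x.1 (Finset.HasAntidiagonal.antidiagonal.fst_le hx), Finset.mul_sum]
        exact Finset.sum_congr rfl fun t _ => by ring
    _ = ∑ t ∈ Finset.range (p + 1),
          r.choose (M + N - t) * (M.choose t * (M + N - t).choose (p - t)) := by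
        rw [Finset.sum_comm]
        exact Finset.sum_congr rfl fun t ht => by rw [← Finset.mul_sum, inner t ht]
    _ = ∑ t ∈ Finset.range (p + 1), r.choose P * (M.choose t * (r - P).choose (p - t)) := by
        refine Finset.sum_congr rfl fun t ht => ?_
        rw [Finset.mem_range] at ht
        have := Nat.choose_mul (n := r) (show P ≤ M + N - t by omega)
        rw [show M + N - t - P = p - t by omega] at this
        rw [Nat.choose_symm_of_eq_add (show M + N - t = (p - t) + P by omega),
          mul_left_comm, this]
        ring
    _ = _ := by
        rcases lt_or_ge r P with h2 | h2
        · simp [Nat.choose_eq_zero_of_lt h2]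
        · rw [← Finset.mul_sum, show M + r - P = M + (r - P) by omega, Nat.add_choose_eq,
            Finset.Nat.sum_antidiagonal_eq_sum_range_succ_mk]

theorem chooseZ_natCast (m r : ℕ) : chooseZ m r = m.choose r := by
  unfold chooseZ
  split_ifs with h
  · simp
  · rw [Nat.choose_eq_zero_of_lt (by omega)]; rfl

theorem chooseZ_eq_zero {m r : ℤ} (h : r < 0 ∨ m < r) : chooseZ m r = 0 :=
  if_neg (by omega)

theorem chooseZ_succ_succ {m r m' r' : ℤ} (hm : 0 ≤ m) (hm' : m' = m + 1) (hr' : r' = r + 1) :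
    chooseZ m' r' = chooseZ m r + chooseZ m r' := by
  subst hm' hr'
  lift m to ℕ using hm
  rcases lt_trichotomy r (-1) with h | rfl | h
  · rw [chooseZ_eq_zero (by omega), chooseZ_eq_zero (by omega), chooseZ_eq_zero (by omega)]; rfl
  · rw [chooseZ_eq_zero (r := -1) (by omega)]
    simpa using (chooseZ_natCast (m + 1) 0).trans (by simpa using (chooseZ_natCast m 0).symm)
  · lift r to ℕ using by omega
    have := chooseZ_natCast (m + 1) (r + 1)
    have h2 := chooseZ_natCast m (r + 1)
    push_cast at this h2
    rw [this, chooseZ_natCast, h2, Nat.choose_succ_succ]; push_cast; rfl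

/-- The product of binomials whose second difference in `a` is summed over `s`. -/
def shiftedProd (a w s n j : ℤ) : ℤ :=
  chooseZ (n - w - 1) (j - w - s - a) * chooseZ (n + w - 1) (j + w + s + a)

/-- The second difference of `shiftedProd` in its first argument. -/
def secondDiff (w s n j : ℤ) : ℤ :=
  shiftedProd 1 w s n j - 2 * shiftedProd 0 w s n j + shiftedProd (-1) w s n j

/-- A product of binomials with the shift in the upper indices. -/
def upperProd (b w s n j : ℤ) : ℤ :=
  chooseZ (n - w + b) (j + 1 - w - s) * chooseZ (n + w - b) (j + 1 + w + s)

theorem secondDiff_eq_upperProd {w s n j : ℤ} (hn : 1 ≤ n) (hw : 0 ≤ w) (hs : 0 ≤ s)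
    (hws : s = 0 → w = 0) :
    secondDiff w s n j = upperProd 1 w s n j - 2 * upperProd 0 w s n j + upperProd (-1) w s n j := by
  rcases lt_or_ge (n - w - 1) 0 with hp | hp
  · have h1 : ∀ a, shiftedProd a w s n j = 0 := fun a => by
      have : chooseZ (n - w - 1) (j - w - s - a) = 0 := chooseZ_eq_zero (by omega)
      rw [shiftedProd, this, zero_mul]
    have h2 : ∀ b, -1 ≤ b → upperProd b w s n j = 0 := fun b hb => by
      rcases lt_or_ge (j + 1 - w - s) 0 with h | h
      · rw [upperProd, chooseZ_eq_zero (Or.inl h), zero_mul]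
      · rw [upperProd, chooseZ_eq_zero (m := n + w - b) (by omega), mul_zero]
    simp only [secondDiff, h1, h2 1 (by omega), h2 0 (by omega), h2 (-1) (by omega)]
  · have pascal : ∀ m, 0 ≤ m → ∀ x, chooseZ (m + 2) (x + 1) =
        chooseZ m (x - 1) + 2 * chooseZ m x + chooseZ m (x + 1) := fun m hm x => by
      rw [chooseZ_succ_succ (m := m + 1) (r := x) (by omega) (by ring) rfl,
        chooseZ_succ_succ (m := m) (r := x - 1) hm rfl (by ring),
        chooseZ_succ_succ (m := m) (r := x) hm rfl rfl]
      ring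
    have pascal' : ∀ m, 0 ≤ m → ∀ x, chooseZ (m + 1) (x + 1) =
        chooseZ m x + chooseZ m (x + 1) := fun m hm x => chooseZ_succ_succ hm rfl rfl
    have hq : 0 ≤ n + w - 1 := by omega
    unfold secondDiff upperProd shiftedProd
    have e1 := pascal _ hp (j - w - s)
    have e2 := pascal _ hq (j + w + s)
    have e3 := pascal' _ hp (j - w - s)
    have e4 := pascal' _ hq (j + w + s)
    ring_nf at e1 e2 e3 e4 ⊢
    rw [e1, e2, e3, e4]
    ring

theorem sum_choose_mul_upperProd {b w s : ℤ} {n j : ℕ} (hn : 1 ≤ n) (hj : 1 ≤ j) (hw : 0 ≤ w)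
    (hs : 0 ≤ s) (hws : s = 0 → w = 0) (hb : -1 ≤ b) (hb' : b ≤ 1) :
    ∑ i ∈ Finset.Icc (-1 : ℤ) j, chooseZ (n + i) (2 * j) * upperProd b w s j i =
      shiftedProd b (w + s) s n j := by
  rcases lt_or_ge (j - b - w - 2 * s) 0 with hp | hp
  · rw [shiftedProd, chooseZ_eq_zero (by omega), zero_mul]
    refine Finset.sum_eq_zero fun i _ => ?_
    rcases lt_or_ge (i + 1 - w - s) 0 with h | h
    · rw [upperProd, chooseZ_eq_zero (Or.inl h), zero_mul, mul_zero]
    · rw [upperProd, chooseZ_eq_zero (m := j + w - b) (by omega), mul_zero, mul_zero]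
  obtain ⟨p, hp'⟩ := Int.eq_ofNat_of_zero_le hp
  obtain ⟨M, hM⟩ := Int.eq_ofNat_of_zero_le (show 0 ≤ j - w + b by omega)
  obtain ⟨N, hN⟩ := Int.eq_ofNat_of_zero_le (show 0 ≤ j + w - b by omega)
  obtain ⟨P, hP⟩ := Int.eq_ofNat_of_zero_le (show 0 ≤ j + b + w + 2 * s by omega)
  obtain ⟨r, hr⟩ := Int.eq_ofNat_of_zero_le (show 0 ≤ n - 1 + w + s by omega)
  have key := Nat.sum_antidiagonal_choose_mul_choose_mul_choose M N P p r (by omega)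
  have rhs : shiftedProd b (w + s) s n j = ((r.choose P * (M + r - P).choose p : ℕ) : ℤ) := by
    rw [shiftedProd, show (n : ℤ) + (w + s) - 1 = r by omega,
      show (j : ℤ) + (w + s) + s + b = P by omega, show (j : ℤ) - (w + s) - s - b = p by omega,
      chooseZ_natCast]
    rcases lt_or_ge r P with h | h
    · simp [Nat.choose_eq_zero_of_lt h]
    · rw [show (n : ℤ) - (w + s) - 1 = (M + r - P : ℕ) by omega, chooseZ_natCast]
      push_cast; ring
  rw [rhs, ← key, Nat.cast_sum]
  symm
  refine Finset.sum_of_injOn (fun x => x.1 - 1 + w + s) ?_ ?_ ?_ ?_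
  · rintro ⟨a, c⟩ h ⟨a', c'⟩ h' e
    simp only [Finset.mem_coe, Finset.HasAntidiagonal.mem_antidiagonal, Prod.mk.injEq] at h h' e ⊢
    omega
  · rintro ⟨a, c⟩ h
    simp only [Finset.mem_coe, Finset.HasAntidiagonal.mem_antidiagonal, Finset.mem_Icc] at h ⊢
    omega
  · intro i _ hi'
    rcases lt_or_ge (i + 1 - w - s) 0 with h | h
    · rw [upperProd, chooseZ_eq_zero (Or.inl h), zero_mul, mul_zero]
    rcases lt_or_ge (j + w - b) (i + 1 + w + s) with h2 | h2
    · rw [upperProd, chooseZ_eq_zero (Or.inr h2), mul_zero, mul_zero]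
    exfalso
    apply hi'
    refine ⟨((i + 1 - w - s).toNat, p - (i + 1 - w - s).toNat), ?_, ?_⟩
    · simp only [Finset.mem_coe, Finset.HasAntidiagonal.mem_antidiagonal]; omega
    · dsimp only; omega
  · rintro ⟨a, c⟩ h
    rw [Finset.HasAntidiagonal.mem_antidiagonal] at h
    dsimp only at h ⊢
    have e : chooseZ (j + w - b) ((a : ℤ) - 1 + w + s + 1 + w + s) = N.choose c := by
      rw [hN]
      rcases lt_or_ge N c with h1 | h1
      · rw [chooseZ_eq_zero (by omega), Nat.choose_eq_zero_of_lt h1]; rfl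
      · rw [← Nat.choose_symm h1, ← chooseZ_natCast]
        congr 1; omega
    rw [upperProd, e, hM, show (a : ℤ) - 1 + w + s + 1 - w - s = a by ring,
      show (n : ℤ) + (a - 1 + w + s) = (r + a : ℕ) by omega,
      show (2 : ℤ) * j = (M + N : ℕ) by omega, chooseZ_natCast, chooseZ_natCast]
    push_cast; ring

theorem sum_choose_mul_secondDiff {w s : ℤ} {n j : ℕ} (hn : 1 ≤ n) (hj : 1 ≤ j) (hw : 0 ≤ w)
    (hs : 0 ≤ s) (hws : s = 0 → w = 0) :
    ∑ i ∈ Finset.range (j + 1), ((n + i).choose (2 * j) : ℤ) * secondDiff w s j i =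
      secondDiff (w + s) s n j := by
  have h : ∑ i ∈ Finset.Icc (-1 : ℤ) j, chooseZ (n + i) (2 * j) * secondDiff w s j i =
      secondDiff (w + s) s n j := by
    conv_rhs => rw [secondDiff]
    rw [← sum_choose_mul_upperProd hn hj hw hs hws (b := 1) (by omega) (by omega),
      ← sum_choose_mul_upperProd hn hj hw hs hws (b := 0) (by omega) (by omega),
      ← sum_choose_mul_upperProd hn hj hw hs hws (b := -1) (by omega) (by omega),
      Finset.mul_sum, ← Finset.sum_sub_distrib, ← Finset.sum_add_distrib]
    refine Finset.sum_congr rfl fun i _ => ?_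
    rw [secondDiff_eq_upperProd (by omega) hw hs hws]
    ring
  rw [← h]
  refine Finset.sum_of_injOn (fun i => (i : ℤ)) ?_ ?_ ?_ ?_
  · intro a _ b _ e
    exact Nat.cast_injective e
  · intro a ha
    simp only [Finset.mem_coe, Finset.mem_range, Finset.mem_Icc] at ha ⊢
    omega
  · intro i hi hi'
    have : i = -1 := by
      by_contra hc
      rw [Finset.mem_Icc] at hi
      refine hi' ⟨i.toNat, ?_, ?_⟩
      · simp only [Finset.mem_coe, Finset.mem_range]; omega
      · dsimp only; omega
    subst this
    have h0 : ∀ a, -1 ≤ a → shiftedProd a w s j (-1) = 0 := fun a ha => by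
      rcases lt_or_ge (-1 - w - s - a) 0 with h | h
      · rw [shiftedProd, chooseZ_eq_zero (Or.inl h), zero_mul]
      · rw [shiftedProd, chooseZ_eq_zero (r := -1 + w + s + a) (by omega), mul_zero]
    simp [secondDiff, h0]
  · intro i _
    rw [← chooseZ_natCast]
    push_cast; rfl

/-- The sum over chains, by recursion on the length of the chain. -/
def chainSum : ℕ → ℕ → ℕ → ℕ
  | 0, _, j => if j = 0 then 1 else 0
  | k + 1, n, j => ∑ i ∈ Finset.range (j + 1), (n + i).choose (2 * j) * chainSum k j i

theorem chainSum_zero_right (k n : ℕ) : chainSum k n 0 = 1 := by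
  induction k generalizing n with
  | zero => rfl
  | succ k ih => simp [chainSum, ih]

/-- The symmetric sum of second differences, up to sign. -/
def diffSum (κ S : ℕ) (n j : ℤ) : ℤ :=
  secondDiff 0 0 n j + 2 * ∑ s ∈ Finset.Icc 1 S, secondDiff (κ * s) s n j

theorem diffSum_succ {κ S n j : ℕ} (hn : 1 ≤ n) (hj : 1 ≤ j) :
    diffSum (κ + 1) S n j =
      ∑ i ∈ Finset.range (j + 1), ((n + i).choose (2 * j) : ℤ) * diffSum κ S j i := by
  simp only [diffSum, mul_add, Finset.sum_add_distrib]
  rw [sum_choose_mul_secondDiff hn hj le_rfl le_rfl (by simp), add_zero]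
  congr 1
  simp only [Finset.mul_sum]
  rw [Finset.sum_comm]
  refine Finset.sum_congr rfl fun s hs => ?_
  have := sum_choose_mul_secondDiff (w := κ * s) (s := s) hn hj (by positivity) (by positivity)
    (fun h => by simp [h])
  rw [show ((κ + 1 : ℕ) : ℤ) * s = κ * s + s by push_cast; ring, ← this, Finset.mul_sum]
  exact Finset.sum_congr rfl fun i _ => by ring

theorem diffSum_zero_left {S n j : ℕ} (hS : j + 1 ≤ S) : diffSum 0 S n j = 0 := by
  set u : ℕ → ℤ := fun s => shiftedProd 0 0 s n j with hu
  have tele : ∀ S : ℕ, ∑ s ∈ Finset.Icc 1 S, secondDiff (((0 : ℕ) : ℤ) * s) s n j =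
      (u (S + 1) - u S) - (u 1 - u 0) := by
    intro S
    induction S with
    | zero => simp
    | succ S ih =>
      rw [Finset.sum_Icc_succ_top (by omega), ih]
      simp only [hu, secondDiff, shiftedProd]
      push_cast
      ring_nf
  have hv : ∀ s : ℕ, j + 1 ≤ s → u s = 0 := fun s hs => by
    simp only [hu]
    rw [shiftedProd, chooseZ_eq_zero (by omega), zero_mul]
  rw [diffSum, tele, hv S hS, hv (S + 1) (by omega)]
  simp only [hu, secondDiff, shiftedProd]
  push_cast
  ring_nf

theorem diffSum_zero_right {κ S n : ℕ} (hn : 1 ≤ n) : diffSum (κ + 1) S n 0 = -2 := by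
  have h : ∀ s ∈ Finset.Icc 1 S, secondDiff ((κ + 1 : ℕ) * s) s n 0 = 0 := by
    intro s hs
    rw [Finset.mem_Icc] at hs
    have hw : (0 : ℤ) ≤ κ * s := by positivity
    have h0 : ∀ a, -1 ≤ a → shiftedProd a ((κ + 1 : ℕ) * s) s n 0 = 0 := fun a ha => by
      rw [shiftedProd, chooseZ_eq_zero, zero_mul]
      left; push_cast; rw [add_mul]; omega
    rw [secondDiff, h0 1 (by omega), h0 0 (by omega), h0 (-1) (by omega)]; rfl
  rw [diffSum, Finset.sum_eq_zero h]
  have h1 : chooseZ ((n : ℤ) - 1) 0 = 1 := by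
    rw [chooseZ, if_pos (by omega)]; simp
  have h2 : chooseZ ((n : ℤ) - 1) (-1) = 0 := chooseZ_eq_zero (by omega)
  simp [secondDiff, shiftedProd, h1, h2]

theorem two_mul_chainSum (k : ℕ) {n j S : ℕ} (hn : 1 ≤ n) (hS : j + 1 ≤ S) :
    2 * (chainSum k n j : ℤ) = -diffSum (k + 1) S n j := by
  induction k generalizing n j with
  | zero =>
    rcases Nat.eq_zero_or_pos j with rfl | hj
    · rw [chainSum_zero_right]; simp [diffSum_zero_right hn]
    · rw [diffSum_succ hn hj, Finset.sum_eq_zero]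
      · simp [chainSum, hj.ne']
      · intro i hi
        rw [Finset.mem_range] at hi
        rw [diffSum_zero_left (by omega), mul_zero]
  | succ k ih =>
    rcases Nat.eq_zero_or_pos j with rfl | hj
    · rw [chainSum_zero_right]; simp [diffSum_zero_right hn]
    · rw [diffSum_succ hn hj, chainSum, Nat.cast_sum, Finset.mul_sum, ← Finset.sum_neg_distrib]
      refine Finset.sum_congr rfl fun i hi => ?_
      rw [Finset.mem_range] at hi
      have := ih (n := j) (j := i) hj (by omega)
      push_cast
      linear_combination ((n + i).choose (2 * j) : ℤ) * this

theorem secondDiff_zero_zero {n j : ℕ} (hn : 1 ≤ n) :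
    ((secondDiff 0 0 n j : ℤ) : ℚ) = -2 * ((n.choose (j + 1) : ℚ) * (n.choose j : ℚ) / n) := by
  obtain ⟨m, rfl⟩ : ∃ m, n = m + 1 := ⟨n - 1, by omega⟩
  have h0 : chooseZ m (j : ℤ) = m.choose j := chooseZ_natCast m j
  have h1 : chooseZ m ((j : ℤ) + 1) = m.choose (j + 1) := chooseZ_natCast m (j + 1)
  have e : secondDiff 0 0 (m + 1 : ℕ) j =
      2 * (chooseZ m ((j : ℤ) - 1) * chooseZ m ((j : ℤ) + 1) - chooseZ m j ^ 2) := by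
    simp only [secondDiff, shiftedProd]
    push_cast
    ring_nf
  rw [e, h0, h1]
  rcases Nat.eq_zero_or_pos j with rfl | hj
  · rw [chooseZ_eq_zero (by omega)]
    push_cast
    have hm : ((m : ℚ) + 1) ≠ 0 := by positivity
    simp [hm]
  obtain ⟨i, rfl⟩ : ∃ i, j = i + 1 := ⟨j - 1, by omega⟩
  have h2 : chooseZ m (((i + 1 : ℕ) : ℤ) - 1) = m.choose i := by
    rw [← chooseZ_natCast]; congr 1; omega
  rw [h2]
  have r1 := Nat.add_one_mul_choose_eq m i
  have r2 := Nat.add_one_mul_choose_eq m (i + 1)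
  have p1 := Nat.choose_succ_succ m i
  have p2 := Nat.choose_succ_succ m (i + 1)
  simp only [Nat.succ_eq_add_one] at r1 r2 p1 p2
  rw [p1] at r1 ⊢
  rw [p2] at r2 ⊢
  have r1' : ((m : ℚ) + 1) * m.choose i = (m.choose i + m.choose (i + 1)) * (i + 1) := by
    exact_mod_cast r1
  have r2' : ((m : ℚ) + 1) * m.choose (i + 1) =
      (m.choose (i + 1) + m.choose (i + 1 + 1)) * (i + 1 + 1) := by exact_mod_cast r2
  have hm : ((m : ℚ) + 1) ≠ 0 := by positivity
  push_cast
  field_simp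
  linear_combination ((m.choose (i + 1) : ℚ) + m.choose (i + 1 + 1)) * r1' -
    ((m.choose i : ℚ) + m.choose (i + 1)) * r2'

theorem V_snoc (n j i K : ℕ) (g : Fin K → ℕ) {m : ℕ} (hm : m ≤ K + 2) :
    V n j (K + 2) (Fin.snoc (α := fun _ => ℕ) g i) m = V j i (K + 1) g m := by
  unfold V
  rcases Nat.lt_or_ge K m with h | h
  · obtain rfl | rfl : m = K + 1 ∨ m = K + 2 := by omega
    · simp [Fin.snoc]
    · simp
  · rcases Nat.eq_zero_or_pos m with rfl | h0
    · simp
    · rw [dif_pos (by omega), dif_pos (by omega)]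
      simp [Fin.snoc, show m - 1 < K by omega]

theorem chain_snoc_iff (n j i K : ℕ) (g : Fin K → ℕ) :
    ((∀ a : Fin (K + 1), Fin.snoc (α := fun _ => ℕ) g i a < j + 1) ∧
      ∀ m, 1 ≤ m ∧ m ≤ K → V n j (K + 2) (Fin.snoc (α := fun _ => ℕ) g i) m ≤
        V n j (K + 2) (Fin.snoc (α := fun _ => ℕ) g i) (m + 1)) ↔
    i < j + 1 ∧ (∀ a, g a < i + 1) ∧
      ∀ m, 1 ≤ m ∧ m ≤ K - 1 → V j i (K + 1) g m ≤ V j i (K + 1) g (m + 1) := by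
  have hV : ∀ a : Fin K, V j i (K + 1) g (a + 1) = g a := fun a => by
    unfold V
    rw [dif_pos (by omega)]
    rfl
  have hi : V j i (K + 1) g (K + 1) = i := by simp [V]
  constructor
  · rintro ⟨h1, h2⟩
    have h3 : ∀ m, 1 ≤ m ∧ m ≤ K → V j i (K + 1) g m ≤ V j i (K + 1) g (m + 1) := fun m hm => by
      have := h2 m hm
      rwa [V_snoc _ _ _ _ _ (by omega), V_snoc _ _ _ _ _ (by omega)] at this
    refine ⟨by simpa using h1 (Fin.last K), fun a => ?_, fun m hm => h3 m (by omega)⟩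
    have mono : ∀ d m, 1 ≤ m → m + d = K + 1 → V j i (K + 1) g m ≤ i := by
      intro d
      induction d with
      | zero => rintro m _ rfl; exact hi.le
      | succ d ih => exact fun m h h' => (h3 m (by omega)).trans (ih (m + 1) (by omega) (by omega))
    have := mono (K - a) (a + 1) (by omega) (by omega)
    rw [hV] at this
    omega
  · rintro ⟨h1, h2, h3⟩
    refine ⟨fun a => ?_, fun m hm => ?_⟩
    · refine Fin.lastCases ?_ (fun a => ?_) a
      · simpa using h1
      · have := h2 a
        simp only [Fin.snoc_castSucc]
        omega
    · rw [V_snoc _ _ _ _ _ (by omega), V_snoc _ _ _ _ _ (by omega)]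
      rcases Nat.lt_or_ge m K with h | h
      · exact h3 m (by omega)
      · obtain rfl : m = K := by omega
        rw [hi]
        have := h2 ⟨m - 1, by omega⟩
        rw [← hV] at this
        simp only [Nat.sub_add_cancel hm.1] at this
        omega

open scoped Classical in
theorem sum_chains_eq_chainSum (n j K : ℕ) :
    (∑ g ∈ (Fintype.piFinset fun _ : Fin (K + 1 - 1) => Finset.range (j + 1)).filter
          (fun g => ∀ m ∈ Finset.Icc 1 (K + 1 - 2), V n j (K + 1) g m ≤ V n j (K + 1) g (m + 1)),
        ∏ m ∈ Finset.range (K + 1),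
          (V n j (K + 1) g (m + 2) + V n j (K + 1) g m).choose (2 * V n j (K + 1) g (m + 1))) =
      chainSum (K + 1) n j := by
  induction K generalizing n j with
  | zero =>
    have h : ((Fintype.piFinset fun _ : Fin (0 + 1 - 1) => Finset.range (j + 1)).filter
        (fun g => ∀ m ∈ Finset.Icc 1 (0 + 1 - 2), V n j (0 + 1) g m ≤ V n j (0 + 1) g (m + 1))) =
        {fun _ => 0} := by
      ext g
      have hg : g = fun _ => 0 := funext fun x => x.elim0
      have hp : ∀ a : Fin (0 + 1 - 1), g a < j + 1 := fun x => x.elim0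
      simp only [Finset.mem_filter, Fintype.mem_piFinset, Finset.mem_singleton, Finset.mem_range]
      exact ⟨fun _ => hg, fun _ => ⟨hp, by simp⟩⟩
    rw [h, Finset.sum_singleton, chainSum]
    simp [chainSum, V]
  | succ K ih =>
    rw [chainSum]
    simp only [← ih, Finset.mul_sum]
    rw [Finset.sum_sigma']
    symm
    refine Finset.sum_bij' (fun x _ => Fin.snoc (α := fun _ => ℕ) x.2 x.1)
      (fun g _ => ⟨g (Fin.last K), Fin.init (α := fun _ => ℕ) g⟩) ?_ ?_ ?_ ?_ ?_
    · rintro ⟨i, g⟩ h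
      simp only [Finset.mem_sigma, Finset.mem_filter, Fintype.mem_piFinset, Finset.mem_range,
        Finset.mem_Icc] at h ⊢
      exact (chain_snoc_iff n j i K g).2 h
    · intro g h
      simp only [Finset.mem_sigma, Finset.mem_filter, Fintype.mem_piFinset, Finset.mem_range,
        Finset.mem_Icc] at h ⊢
      refine (chain_snoc_iff n j _ K _).1 ?_
      rw [Fin.snoc_init_self]
      exact h
    · rintro ⟨i, g⟩ _
      simp only [Fin.snoc_last, Fin.init_snoc]
    · intro g _
      exact Fin.snoc_init_self (α := fun _ => ℕ) g
    · rintro ⟨i, g⟩ _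
      rw [Finset.prod_range_succ (n := K + 1), mul_comm]
      congr 1
      · refine Finset.prod_congr rfl fun m hm => ?_
        rw [Finset.mem_range] at hm
        rw [V_snoc _ _ _ _ _ (by omega), V_snoc _ _ _ _ _ (by omega), V_snoc _ _ _ _ _ (by omega)]
      · rw [V_snoc _ _ _ _ _ (m := K + 1) (by omega)]
        simp [V]

theorem Qt_eq (a : ℤ) (n j k : ℕ) :
    Qt a n j k = ((∑ s ∈ Finset.Icc 1 (j + 1),
      shiftedProd a ((k + 1 : ℕ) * s) s n j : ℤ) : ℚ) := by
  rw [Qt, Int.cast_sum]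
  refine Finset.sum_congr rfl fun s _ => ?_
  rw [shiftedProd]
  push_cast
  ring_nf

open scoped Classical in
theorem binomial_identity (n j k : ℕ) (hn : 1 ≤ n) (hk : 2 ≤ k) :
    ((∑ g ∈ (Fintype.piFinset fun _ : Fin (k - 1) => Finset.range (j + 1)).filter
          (fun g => ∀ m ∈ Finset.Icc 1 (k - 2), V n j k g m ≤ V n j k g (m + 1)),
        ∏ m ∈ Finset.range k,
          (V n j k g (m + 2) + V n j k g m).choose (2 * V n j k g (m + 1)) : ℕ) : ℚ) =
      (n.choose (j + 1) : ℚ) * (n.choose j : ℚ) / n -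
        Qt 1 n j k + 2 * Qt 0 n j k - Qt (-1) n j k := by
  have h := two_mul_chainSum k (S := j + 1) hn le_rfl
  obtain ⟨K, rfl⟩ : ∃ K, k = K + 1 := ⟨k - 1, by omega⟩
  rw [sum_chains_eq_chainSum, Qt_eq, Qt_eq, Qt_eq]
  have h' : (2 : ℚ) * (chainSum (K + 1) n j : ℚ) = -((diffSum (K + 1 + 1) (j + 1) n j : ℤ) : ℚ) := by
    exact_mod_cast h
  simp only [diffSum, secondDiff, Finset.sum_add_distrib, Finset.sum_sub_distrib,
    ← Finset.mul_sum] at h'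
  have h0 := secondDiff_zero_zero (j := j) hn
  simp only [secondDiff] at h0
  push_cast at h' h0 ⊢
  linarith
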